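/- Let ψ = (a₁,a₂,a₃,b₁,b₂,b₃) be a real vector such that the matrix V = 𝒱(ψ) satisfies V_{ij} > 0 whenever i ∉ {j−1, j} (indices mod 7), and suppose V has full nonnegative rank, i.e., V admits no factorization V = B·C with B a nonnegative 7×6 matrix and C a nonnegative 6×7 matrix. Then either α₁(t) + β₁(t) < α₂(t) + β₂(t) < α₃(t) + β₃(t) for every nonnegative integer t, or α₁(t) + β₁(t) > α₂(t) + β₂(t) > α₃(t) + β₃(t) for every nonnegative integer t. -/

import Mathlib

/-- The rows of the 7-by-3 matrix `W(a₁,a₂,a₃,b₁,b₂,b₃)`, indexed by `ZMod 7`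
(index `k` representing the `k`-th row, with `7 ≡ 0`): `Wrow ... k` is the
`k`-th column of the 3-by-7 matrix with rows `(0,0,1,1,a₁,a₂,a₃)`,
`(1,0,0,1,1,1,1)`, `(1,1,0,0,b₁,b₂,b₃)`. -/
noncomputable def Wrow (a₁ a₂ a₃ b₁ b₂ b₃ : ℝ) (k : ZMod 7) : Fin 3 → ℝ :=
  fun r =>
    (Matrix.of ![![(0 : ℝ), 0, 1, 1, a₁, a₂, a₃],
                 ![1, 0, 0, 1, 1, 1, 1],
                 ![1, 1, 0, 0, b₁, b₂, b₃]]) r ⟨(k - 1).val, ZMod.val_lt _⟩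

/-- The 7-by-7 matrix `𝒱(a₁,a₂,a₃,b₁,b₂,b₃)`, indexed by `ZMod 7`: its `(i,j)` entry
is the determinant of the 3-by-3 matrix with rows `W_{i-1}`, `W_{j-2}`, `W_{j-1}`. -/
noncomputable def Vmat (a₁ a₂ a₃ b₁ b₂ b₃ : ℝ) : Matrix (ZMod 7) (ZMod 7) ℝ :=
  Matrix.of fun i j =>
    Matrix.det (Matrix.of ![Wrow a₁ a₂ a₃ b₁ b₂ b₃ (i - 1),
                            Wrow a₁ a₂ a₃ b₁ b₂ b₃ (j - 2),
                            Wrow a₁ a₂ a₃ b₁ b₂ b₃ (j - 1)])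

/-- The six sequences `α₁(t),α₂(t),α₃(t),β₁(t),β₂(t),β₃(t)` of Notation 4, packaged as
`seqV a₁ a₂ a₃ b₁ b₂ b₃ t = ((α₁(t), α₂(t), α₃(t)), (β₁(t), β₂(t), β₃(t)))`, with
initial value `((a₁,a₂,a₃),(b₁,b₂,b₃))` and the recursions
`α₁(t+1) = (1 - α₃(t) - β₃(t))/(1 - β₃(t))`,
`α_{χ+1}(t+1) = (α_χ(t) - α_χ(t)β₃(t) - α₃(t) + α₃(t)β_χ(t))/(α_χ(t) - α_χ(t)β₃(t))`
for `χ ∈ {1,2}`, `β₁(t+1) = α₃(t)`, `β₂(t+1) = α₃(t)/α₁(t)`, `β₃(t+1) = α₃(t)/α₂(t)`. -/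
noncomputable def seqV (a₁ a₂ a₃ b₁ b₂ b₃ : ℝ) : ℕ → (ℝ × ℝ × ℝ) × (ℝ × ℝ × ℝ)
  | 0 => ((a₁, a₂, a₃), (b₁, b₂, b₃))
  | t + 1 =>
      let s := seqV a₁ a₂ a₃ b₁ b₂ b₃ t
      let α₁ := s.1.1
      let α₂ := s.1.2.1
      let α₃ := s.1.2.2
      let β₁ := s.2.1
      let β₂ := s.2.2.1
      let β₃ := s.2.2.2
      (((1 - α₃ - β₃) / (1 - β₃),
        (α₁ - α₁ * β₃ - α₃ + α₃ * β₁) / (α₁ - α₁ * β₃),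
        (α₂ - α₂ * β₃ - α₃ + α₃ * β₂) / (α₂ - α₂ * β₃)),
       (α₃, α₃ / α₁, α₃ / α₂))

/-- `alphaV χ t` is `α_χ(t)` (for `χ ∈ {1,2,3}`, 1-indexed via `Fin 3`). -/
noncomputable def alphaV (a₁ a₂ a₃ b₁ b₂ b₃ : ℝ) (χ : Fin 3) (t : ℕ) : ℝ :=
  ![(seqV a₁ a₂ a₃ b₁ b₂ b₃ t).1.1,
    (seqV a₁ a₂ a₃ b₁ b₂ b₃ t).1.2.1,
    (seqV a₁ a₂ a₃ b₁ b₂ b₃ t).1.2.2] χ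

/-- `betaV χ t` is `β_χ(t)` (for `χ ∈ {1,2,3}`, 1-indexed via `Fin 3`). -/
noncomputable def betaV (a₁ a₂ a₃ b₁ b₂ b₃ : ℝ) (χ : Fin 3) (t : ℕ) : ℝ :=
  ![(seqV a₁ a₂ a₃ b₁ b₂ b₃ t).2.1,
    (seqV a₁ a₂ a₃ b₁ b₂ b₃ t).2.2.1,
    (seqV a₁ a₂ a₃ b₁ b₂ b₃ t).2.2.2] χ

section helpers

/-- Explicit three by three determinant. -/
noncomputable def hepDet (u v w : Fin 3 → ℝ) : ℝ :=
  u 0 * (v 1 * w 2 - v 2 * w 1) - u 1 * (v 0 * w 2 - v 2 * w 0)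
    + u 2 * (v 0 * w 1 - v 1 * w 0)

theorem hep_Vmat_apply (a₁ a₂ a₃ b₁ b₂ b₃ : ℝ) (i j : ZMod 7) :
    Vmat a₁ a₂ a₃ b₁ b₂ b₃ i j =
      hepDet (Wrow a₁ a₂ a₃ b₁ b₂ b₃ (i - 1)) (Wrow a₁ a₂ a₃ b₁ b₂ b₃ (j - 2))
        (Wrow a₁ a₂ a₃ b₁ b₂ b₃ (j - 1)) := by
  simp only [Vmat, hepDet, Matrix.of_apply, Matrix.det_fin_three]
  simp only [Matrix.cons_val]
  ring

theorem hep_W0 (a₁ a₂ a₃ b₁ b₂ b₃ : ℝ) : Wrow a₁ a₂ a₃ b₁ b₂ b₃ 0 = ![a₃, 1, b₃] := by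
  ext r; fin_cases r <;> rfl
theorem hep_W1 (a₁ a₂ a₃ b₁ b₂ b₃ : ℝ) : Wrow a₁ a₂ a₃ b₁ b₂ b₃ 1 = ![0, 1, 1] := by
  ext r; fin_cases r <;> rfl
theorem hep_W2 (a₁ a₂ a₃ b₁ b₂ b₃ : ℝ) : Wrow a₁ a₂ a₃ b₁ b₂ b₃ 2 = ![0, 0, 1] := by
  ext r; fin_cases r <;> rfl
theorem hep_W3 (a₁ a₂ a₃ b₁ b₂ b₃ : ℝ) : Wrow a₁ a₂ a₃ b₁ b₂ b₃ 3 = ![1, 0, 0] := by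
  ext r; fin_cases r <;> rfl
theorem hep_W4 (a₁ a₂ a₃ b₁ b₂ b₃ : ℝ) : Wrow a₁ a₂ a₃ b₁ b₂ b₃ 4 = ![1, 1, 0] := by
  ext r; fin_cases r <;> rfl
theorem hep_W5 (a₁ a₂ a₃ b₁ b₂ b₃ : ℝ) : Wrow a₁ a₂ a₃ b₁ b₂ b₃ 5 = ![a₁, 1, b₁] := by
  ext r; fin_cases r <;> rfl
theorem hep_W6 (a₁ a₂ a₃ b₁ b₂ b₃ : ℝ) : Wrow a₁ a₂ a₃ b₁ b₂ b₃ 6 = ![a₂, 1, b₂] := by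
  ext r; fin_cases r <;> rfl

/-- The linear functional vanishing on the edge with index `j`. -/
noncomputable def hepE (a₁ a₂ a₃ b₁ b₂ b₃ : ℝ) (j : Fin 7) (x m y : ℝ) : ℝ :=
  ![x * (b₂ - b₁) - m * (a₁ * b₂ - b₁ * a₂) + y * (a₁ - a₂),
    x * (b₃ - b₂) - m * (a₂ * b₃ - b₂ * a₃) + y * (a₂ - a₃),
    x * (1 - b₃) - m * a₃ + y * a₃,
    x, m, y,
    x * b₁ - m * b₁ + y * (1 - a₁)] j

theorem hep_forall (P : ZMod 7 → Prop) (h0 : P 0) (h1 : P 1) (h2 : P 2) (h3 : P 3)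
    (h4 : P 4) (h5 : P 5) (h6 : P 6) : ∀ i, P i := by
  intro i
  change Fin 7 at i
  fin_cases i
  exacts [h0, h1, h2, h3, h4, h5, h6]

theorem hep_Vmat_E (a₁ a₂ a₃ b₁ b₂ b₃ : ℝ) (i j : ZMod 7) :
    Vmat a₁ a₂ a₃ b₁ b₂ b₃ i j =
      hepE a₁ a₂ a₃ b₁ b₂ b₃ j (Wrow a₁ a₂ a₃ b₁ b₂ b₃ (i - 1) 0)
        (Wrow a₁ a₂ a₃ b₁ b₂ b₃ (i - 1) 1) (Wrow a₁ a₂ a₃ b₁ b₂ b₃ (i - 1) 2) := by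
  rw [hep_Vmat_apply]
  generalize Wrow a₁ a₂ a₃ b₁ b₂ b₃ (i - 1) = u
  revert j
  apply hep_forall
  · rw [show (0 : ZMod 7) - 2 = 5 by decide, show (0 : ZMod 7) - 1 = 6 by decide, hep_W5, hep_W6]
    simp [hepDet, hepE]
  · rw [show (1 : ZMod 7) - 2 = 6 by decide, show (1 : ZMod 7) - 1 = 0 by decide, hep_W6, hep_W0]
    simp [hepDet, hepE]
  · rw [show (2 : ZMod 7) - 2 = 0 by decide, show (2 : ZMod 7) - 1 = 1 by decide, hep_W0, hep_W1]
    simp [hepDet, hepE]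
  · rw [show (3 : ZMod 7) - 2 = 1 by decide, show (3 : ZMod 7) - 1 = 2 by decide, hep_W1, hep_W2]
    simp [hepDet, hepE]
  · rw [show (4 : ZMod 7) - 2 = 2 by decide, show (4 : ZMod 7) - 1 = 3 by decide, hep_W2, hep_W3]
    simp [hepDet, hepE]
  · rw [show (5 : ZMod 7) - 2 = 3 by decide, show (5 : ZMod 7) - 1 = 4 by decide, hep_W3, hep_W4]
    simp [hepDet, hepE]
  · rw [show (6 : ZMod 7) - 2 = 4 by decide, show (6 : ZMod 7) - 1 = 5 by decide, hep_W4, hep_W5]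
    simp [hepDet, hepE]

/-- Coordinates of the vertex belonging to row `i`. -/
theorem hep_rows (a₁ a₂ a₃ b₁ b₂ b₃ : ℝ) (j : ZMod 7) :
    Vmat a₁ a₂ a₃ b₁ b₂ b₃ 0 j = hepE a₁ a₂ a₃ b₁ b₂ b₃ j a₂ 1 b₂ ∧
    Vmat a₁ a₂ a₃ b₁ b₂ b₃ 1 j = hepE a₁ a₂ a₃ b₁ b₂ b₃ j a₃ 1 b₃ ∧
    Vmat a₁ a₂ a₃ b₁ b₂ b₃ 2 j = hepE a₁ a₂ a₃ b₁ b₂ b₃ j 0 1 1 ∧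
    Vmat a₁ a₂ a₃ b₁ b₂ b₃ 3 j = hepE a₁ a₂ a₃ b₁ b₂ b₃ j 0 0 1 ∧
    Vmat a₁ a₂ a₃ b₁ b₂ b₃ 4 j = hepE a₁ a₂ a₃ b₁ b₂ b₃ j 1 0 0 ∧
    Vmat a₁ a₂ a₃ b₁ b₂ b₃ 5 j = hepE a₁ a₂ a₃ b₁ b₂ b₃ j 1 1 0 ∧
    Vmat a₁ a₂ a₃ b₁ b₂ b₃ 6 j = hepE a₁ a₂ a₃ b₁ b₂ b₃ j a₁ 1 b₁ := by
  refine ⟨?_, ?_, ?_, ?_, ?_, ?_, ?_⟩ <;> rw [hep_Vmat_E]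
  · rw [show (0 : ZMod 7) - 1 = 6 by decide, hep_W6]; rfl
  · rw [show (1 : ZMod 7) - 1 = 0 by decide, hep_W0]; rfl
  · rw [show (2 : ZMod 7) - 1 = 1 by decide, hep_W1]; rfl
  · rw [show (3 : ZMod 7) - 1 = 2 by decide, hep_W2]; rfl
  · rw [show (4 : ZMod 7) - 1 = 3 by decide, hep_W3]; rfl
  · rw [show (5 : ZMod 7) - 1 = 4 by decide, hep_W4]; rfl
  · rw [show (6 : ZMod 7) - 1 = 5 by decide, hep_W5]; rfl

/-- The matrix has the sign pattern of a heptagon. -/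
def HepPos (V : Matrix (ZMod 7) (ZMod 7) ℝ) : Prop :=
  ∀ i j : ZMod 7, i ≠ j - 1 → i ≠ j → 0 < V i j

/-- The matrix factors through six nonnegative terms. -/
def HepFac (V : Matrix (ZMod 7) (ZMod 7) ℝ) : Prop :=
  ∃ (B : Matrix (ZMod 7) (Fin 6) ℝ) (C : Matrix (Fin 6) (ZMod 7) ℝ),
    (∀ i j, 0 ≤ B i j) ∧ (∀ i j, 0 ≤ C i j) ∧ V = B * C

/-- `V'` is a positive rescaling of the shift of `V` by `k`. -/
def HepShift (V V' : Matrix (ZMod 7) (ZMod 7) ℝ) (k : ZMod 7) : Prop :=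
  ∃ c d : ZMod 7 → ℝ, (∀ i, 0 < c i) ∧ (∀ j, 0 < d j) ∧
    ∀ i j, V' i j = c i * d j * V (i - k) (j - k)

theorem HepShift.comp {V V' V'' : Matrix (ZMod 7) (ZMod 7) ℝ} {k l : ZMod 7}
    (h : HepShift V V' k) (h' : HepShift V' V'' l) : HepShift V V'' (k + l) := by
  obtain ⟨c, d, hc, hd, h⟩ := h
  obtain ⟨c', d', hc', hd', h'⟩ := h'
  refine ⟨fun i => c' i * c (i - l), fun j => d' j * d (j - l),
    fun i => mul_pos (hc' _) (hc _), fun j => mul_pos (hd' _) (hd _), fun i j => ?_⟩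
  rw [h', h, sub_sub, sub_sub, add_comm l k]
  ring

theorem HepShift.pos {V V' : Matrix (ZMod 7) (ZMod 7) ℝ} {k : ZMod 7}
    (h : HepShift V V' k) (hV : HepPos V) : HepPos V' := by
  obtain ⟨c, d, hc, hd, h⟩ := h
  intro i j hij hij'
  rw [h]
  refine mul_pos (mul_pos (hc _) (hd _)) (hV _ _ ?_ ?_)
  · intro e; apply hij; linear_combination e
  · intro e; apply hij'; linear_combination e

theorem HepShift.fac {V V' : Matrix (ZMod 7) (ZMod 7) ℝ} {k : ZMod 7}
    (h : HepShift V V' k) (hV : HepFac V') : HepFac V := by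
  obtain ⟨c, d, hc, hd, h⟩ := h
  obtain ⟨B, C, hB, hC, e⟩ := hV
  refine ⟨Matrix.of fun i l => (c (i + k))⁻¹ * B (i + k) l,
    Matrix.of fun l j => (d (j + k))⁻¹ * C l (j + k),
    fun i l => mul_nonneg (inv_nonneg.2 (hc _).le) (hB _ _),
    fun l j => mul_nonneg (inv_nonneg.2 (hd _).le) (hC _ _), ?_⟩
  ext i j
  have e1 := h (i + k) (j + k)
  rw [e, Matrix.mul_apply, add_sub_cancel_right, add_sub_cancel_right] at e1
  have h1 := (hc (i + k)).ne'
  have h2 := (hd (j + k)).ne'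
  have e2 : V i j = (c (i + k))⁻¹ * (d (j + k))⁻¹ * ∑ l, B (i + k) l * C l (j + k) := by
    rw [e1]; field_simp
  rw [e2, Matrix.mul_apply, Finset.mul_sum]
  exact Finset.sum_congr rfl fun l _ => by simp only [Matrix.of_apply]; ring

/-- First family of two by two minors. -/
def hepT (V : Matrix (ZMod 7) (ZMod 7) ℝ) (k : ZMod 7) : ℝ :=
  V (5 + k) (4 + k) * V (2 + k) (0 + k) - V (2 + k) (4 + k) * V (5 + k) (0 + k)

/-- Second family of two by two minors. -/
def hepS (V : Matrix (ZMod 7) (ZMod 7) ℝ) (k : ZMod 7) : ℝ :=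
  V (2 + k) (4 + k) * V (5 + k) (1 + k) - V (2 + k) (1 + k) * V (5 + k) (4 + k)

theorem HepShift.T {V V' : Matrix (ZMod 7) (ZMod 7) ℝ} {k : ZMod 7}
    (h : HepShift V V' k) (l : ZMod 7) : ∃ e : ℝ, 0 < e ∧ hepT V' l = e * hepT V (l - k) := by
  obtain ⟨c, d, hc, hd, h⟩ := h
  refine ⟨c (5 + l) * c (2 + l) * (d (4 + l) * d (0 + l)),
    mul_pos (mul_pos (hc _) (hc _)) (mul_pos (hd _) (hd _)), ?_⟩
  simp only [hepT, h, add_sub_assoc]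
  ring

theorem HepShift.S {V V' : Matrix (ZMod 7) (ZMod 7) ℝ} {k : ZMod 7}
    (h : HepShift V V' k) (l : ZMod 7) : ∃ e : ℝ, 0 < e ∧ hepS V' l = e * hepS V (l - k) := by
  obtain ⟨c, d, hc, hd, h⟩ := h
  refine ⟨c (5 + l) * c (2 + l) * (d (4 + l) * d (1 + l)),
    mul_pos (mul_pos (hc _) (hc _)) (mul_pos (hd _) (hd _)), ?_⟩
  simp only [hepS, h, add_sub_assoc]
  ring

/-- The inequalities describing a normalized convex heptagon. -/
theorem hep_ineqs {a₁ a₂ a₃ b₁ b₂ b₃ : ℝ} (h : HepPos (Vmat a₁ a₂ a₃ b₁ b₂ b₃)) :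
    (0 < a₃ ∧ a₃ < a₂ ∧ a₂ < a₁ ∧ a₁ < 1) ∧ (0 < b₁ ∧ b₁ < b₂ ∧ b₂ < b₃ ∧ b₃ < 1) ∧
    0 < a₂ * b₁ - b₁ + b₂ * (1 - a₁) ∧
    0 < a₃ * b₁ - b₁ + b₃ * (1 - a₁) ∧
    0 < 1 - a₁ - b₁ ∧
    0 < a₃ * (b₂ - b₁) - (a₁ * b₂ - b₁ * a₂) + b₃ * (a₁ - a₂) ∧
    0 < (a₁ - a₂) - (a₁ * b₂ - b₁ * a₂) ∧
    0 < (b₂ - b₁) - (a₁ * b₂ - b₁ * a₂) ∧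
    0 < a₁ * (b₃ - b₂) - (a₂ * b₃ - b₂ * a₃) + b₁ * (a₂ - a₃) ∧
    0 < (a₂ - a₃) - (a₂ * b₃ - b₂ * a₃) ∧
    0 < a₁ * (1 - b₃) - a₃ + b₁ * a₃ ∧
    0 < a₂ * (1 - b₃) - a₃ + b₂ * a₃ := by
  have r := hep_rows a₁ a₂ a₃ b₁ b₂ b₃
  refine ⟨⟨?_, ?_, ?_, ?_⟩, ⟨?_, ?_, ?_, ?_⟩, ?_, ?_, ?_, ?_, ?_, ?_, ?_, ?_, ?_, ?_⟩
  · have := h 1 3 (by decide) (by decide)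
    rw [(r 3).2.1] at this; simpa [hepE] using this
  · have := h 3 1 (by decide) (by decide)
    rw [(r 1).2.2.2.1] at this; simpa [hepE] using this
  · have := h 3 0 (by decide) (by decide)
    rw [(r 0).2.2.2.1] at this; simpa [hepE] using this
  · have := h 3 6 (by decide) (by decide)
    rw [(r 6).2.2.2.1] at this; simpa [hepE] using this
  · have := h 4 6 (by decide) (by decide)
    rw [(r 6).2.2.2.2.1] at this; simpa [hepE] using this
  · have := h 4 0 (by decide) (by decide)
    rw [(r 0).2.2.2.2.1] at this; simpa [hepE] using this
  · have := h 4 1 (by decide) (by decide)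
    rw [(r 1).2.2.2.2.1] at this; simpa [hepE] using this
  · have := h 4 2 (by decide) (by decide)
    rw [(r 2).2.2.2.2.1] at this; simpa [hepE] using this
  · have := h 0 6 (by decide) (by decide)
    rw [(r 6).1] at this; simp [hepE] at this; linarith
  · have := h 1 6 (by decide) (by decide)
    rw [(r 6).2.1] at this; simp [hepE] at this; linarith
  · have := h 2 6 (by decide) (by decide)
    rw [(r 6).2.2.1] at this; simp [hepE] at this; linarith
  · have := h 1 0 (by decide) (by decide)
    rw [(r 0).2.1] at this; simp [hepE] at this; linarith
  · have := h 2 0 (by decide) (by decide)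
    rw [(r 0).2.2.1] at this; simp [hepE] at this; linarith
  · have := h 5 0 (by decide) (by decide)
    rw [(r 0).2.2.2.2.2.1] at this; simp [hepE] at this; linarith
  · have := h 6 1 (by decide) (by decide)
    rw [(r 1).2.2.2.2.2.2] at this; simp [hepE] at this; linarith
  · have := h 2 1 (by decide) (by decide)
    rw [(r 1).2.2.1] at this; simp [hepE] at this; linarith
  · have := h 6 2 (by decide) (by decide)
    rw [(r 2).2.2.2.2.2.2] at this; simp [hepE] at this; linarith
  · have := h 0 2 (by decide) (by decide)
    rw [(r 2).1] at this; simp [hepE] at this; linarith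

set_option maxHeartbeats 4000000 in
theorem hep_factor {a₁ a₂ a₃ b₁ b₂ b₃ : ℝ} (h : HepPos (Vmat a₁ a₂ a₃ b₁ b₂ b₃))
    (hT : 0 ≤ hepT (Vmat a₁ a₂ a₃ b₁ b₂ b₃) 2) (hS : 0 ≤ hepS (Vmat a₁ a₂ a₃ b₁ b₂ b₃) (-2)) :
    HepFac (Vmat a₁ a₂ a₃ b₁ b₂ b₃) := by
  obtain ⟨⟨a3p, a32, a21, a11⟩, ⟨b1p, b12, b23, b31⟩, hP, h745, -, h756, -, -, h567, -, h571,
    hr⟩ := hep_ineqs h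
  have r := hep_rows a₁ a₂ a₃ b₁ b₂ b₃
  have hT' : 0 ≤ (a₂ * b₁ - b₁ + b₂ * (1 - a₁)) * (1 - b₃)
      - b₁ * (a₂ * (1 - b₃) - a₃ + b₂ * a₃) := by
    rw [hepT, show (5 : ZMod 7) + 2 = 0 by decide, show (4 : ZMod 7) + 2 = 6 by decide,
      show (2 : ZMod 7) + 2 = 4 by decide, show (0 : ZMod 7) + 2 = 2 by decide,
      (r 6).1, (r 2).2.2.2.2.1, (r 6).2.2.2.2.1, (r 2).1] at hT
    simpa [hepE] using hT
  have hS' : 0 ≤ (a₂ * (1 - b₃) - a₃ + b₂ * a₃) * (1 - a₁)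
      - (a₂ * b₁ - b₁ + b₂ * (1 - a₁)) * a₃ := by
    rw [hepS, show (5 : ZMod 7) + -2 = 3 by decide, show (4 : ZMod 7) + -2 = 2 by decide,
      show (2 : ZMod 7) + -2 = 0 by decide, show (1 : ZMod 7) + -2 = 6 by decide,
      (r 2).1, (r 6).2.2.2.1, (r 6).1, (r 2).2.2.2.1] at hS
    simpa [hepE] using hS
  have a2p : 0 < a₂ := by linarith
  have a1p : 0 < a₁ := by linarith
  have b2p : 0 < b₂ := by linarith
  have b3p : 0 < b₃ := by linarith
  have e1 : 0 < a₂ - a₃ := by linarith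
  have e2 : 0 < a₁ - a₂ := by linarith
  have e3 : 0 < b₂ - b₁ := by linarith
  have e4 : 0 < b₃ - b₂ := by linarith
  have e5 : 0 < a₂ * b₃ - a₃ * b₂ := by nlinarith
  have e6 : 0 < a₁ * b₂ - a₂ * b₁ := by nlinarith
  obtain ⟨P, hPe⟩ : ∃ P, P = a₂ * b₁ - b₁ + b₂ * (1 - a₁) := ⟨_, rfl⟩
  obtain ⟨R, hRe⟩ : ∃ R, R = a₂ * (1 - b₃) - a₃ + b₂ * a₃ := ⟨_, rfl⟩
  rw [← hPe] at hP hT' hS'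
  rw [← hRe] at hr hT' hS'
  have e7 : 0 ≤ b₁ * (R * (1 - a₁) - P * a₃) := mul_nonneg b1p.le hS'
  have e8 : 0 ≤ a₃ * (P * (1 - b₃) - b₁ * R) := mul_nonneg a3p.le hT'
  refine ⟨(Matrix.of ![
      ![0, 1 / (b₁ * a₃), 0, 0, 1 / (b₁ * a₃), 0],
      ![1 / (b₁ * a₂), 0, 0, 0, 1 / (b₁ * a₂), 0],
      ![1 / (b₁ * (a₂ - a₃)), 0, 0, 1 / (b₁ * (a₂ - a₃)), 0, 0],
      ![0, 1 / (b₁ * R), 0, 1 / (b₁ * R), 0, 0],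
      ![0, 1 / (a₃ * P), 0, 0, 0, 1 / (a₃ * P)],
      ![0, 0, 1 / (a₃ * (b₂ - b₁)), 0, 0, 1 / (a₃ * (b₂ - b₁))],
      ![0, 0, 1 / (a₃ * b₂), 0, 1 / (a₃ * b₂), 0]] : Matrix (Fin 7) (Fin 6) ℝ),
    (Matrix.of ![
      ![b₁ * a₂ * (a₃ * (b₂ - b₁) - (a₁ * b₂ - b₁ * a₂) + b₃ * (a₁ - a₂)), 0, 0, 0,
        b₁ * (a₂ - a₃), b₁ * (a₂ * b₃ - a₃ * b₂), b₁ * a₂ * (a₃ * b₁ - b₁ + b₃ * (1 - a₁))],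
      ![0, 0, b₁ * R * a₃, 0, 0, 0, a₃ * P * b₁],
      ![0, a₃ * b₂ * (a₁ * (b₃ - b₂) - (a₂ * b₃ - b₂ * a₃) + b₁ * (a₂ - a₃)),
        a₃ * b₂ * (a₁ * (1 - b₃) - a₃ + b₁ * a₃), a₃ * (a₁ * b₂ - a₂ * b₁), a₃ * (b₂ - b₁), 0, 0],
      ![b₁ * R * (a₁ - a₂), b₁ * R * (a₂ - a₃), 0, 0, 0, b₁ * R, b₁ * (R * (1 - a₁) - P * a₃)],
      ![0, 0, 0, b₁ * a₃ * a₂, b₁ * a₃, b₁ * a₃ * b₂, 0],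
      ![a₃ * P * (b₂ - b₁), a₃ * P * (b₃ - b₂), a₃ * (P * (1 - b₃) - b₁ * R), a₃ * P, 0, 0, 0]]
      : Matrix (Fin 6) (Fin 7) ℝ), ?_, ?_, ?_⟩
  · intro i j
    change Fin 7 at i
    fin_cases i <;> fin_cases j <;> simp <;> positivity
  · intro i j
    change Fin 7 at j
    fin_cases i <;> fin_cases j <;> simp <;> first | assumption | positivity
  · ext i j
    refine Eq.trans ?_ (Matrix.mul_apply ..).symm
    rw [Fin.sum_univ_six]
    have n1 := a3p.ne'
    have n2 := a2p.ne'
    have n3 := b1p.ne'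
    have n4 := b2p.ne'
    have n5 := e1.ne'
    have n6 := e3.ne'
    have n7 := hP.ne'
    have n8 := hr.ne'
    change Fin 7 at i
    fin_cases i
    · refine (r j).1.trans ?_
      change Fin 7 at j
      fin_cases j <;> simp [hepE] <;> (try field_simp) <;> (try simp only [hPe, hRe]) <;> ring
    · refine (r j).2.1.trans ?_
      change Fin 7 at j
      fin_cases j <;> simp [hepE] <;> (try field_simp) <;> (try simp only [hPe, hRe]) <;> ring
    · refine (r j).2.2.1.trans ?_
      change Fin 7 at j
      fin_cases j <;> simp [hepE] <;> (try field_simp) <;> (try simp only [hPe, hRe]) <;> ring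
    · refine (r j).2.2.2.1.trans ?_
      change Fin 7 at j
      fin_cases j <;> simp [hepE] <;> (try field_simp) <;> (try simp only [hPe, hRe]) <;> ring
    · refine (r j).2.2.2.2.1.trans ?_
      change Fin 7 at j
      fin_cases j <;> simp [hepE] <;> (try field_simp) <;> (try simp only [hPe, hRe]) <;> ring
    · refine (r j).2.2.2.2.2.1.trans ?_
      change Fin 7 at j
      fin_cases j <;> simp [hepE] <;> (try field_simp) <;> (try simp only [hPe, hRe]) <;> ring
    · refine (r j).2.2.2.2.2.2.trans ?_
      change Fin 7 at j
      fin_cases j <;> simp [hepE] <;> (try field_simp) <;> (try simp only [hPe, hRe]) <;> ring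

theorem hepDet_smul_mul (M : Fin 3 → Fin 3 → ℝ) (c d e : ℝ) (u v w u' v' w' : Fin 3 → ℝ)
    (hu : ∀ r, u' r = c * (M r 0 * u 0 + M r 1 * u 1 + M r 2 * u 2))
    (hv : ∀ r, v' r = d * (M r 0 * v 0 + M r 1 * v 1 + M r 2 * v 2))
    (hw : ∀ r, w' r = e * (M r 0 * w 0 + M r 1 * w 1 + M r 2 * w 2)) :
    hepDet u' v' w' = c * (d * e * hepDet (M 0) (M 1) (M 2)) * hepDet u v w := by
  simp only [hepDet, hu, hv, hw]
  ring

theorem hep_step {a₁ a₂ a₃ b₁ b₂ b₃ : ℝ} (h : HepPos (Vmat a₁ a₂ a₃ b₁ b₂ b₃)) :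
    HepShift (Vmat a₁ a₂ a₃ b₁ b₂ b₃)
      (Vmat ((1 - a₃ - b₃) / (1 - b₃)) ((a₁ - a₁ * b₃ - a₃ + a₃ * b₁) / (a₁ - a₁ * b₃))
        ((a₂ - a₂ * b₃ - a₃ + a₃ * b₂) / (a₂ - a₂ * b₃)) a₃ (a₃ / a₁) (a₃ / a₂)) 1 := by
  obtain ⟨⟨a3p, a32, a21, a11⟩, ⟨b1p, b12, b23, b31⟩, -⟩ := hep_ineqs h
  have a2p : 0 < a₂ := by linarith
  have a1p : 0 < a₁ := by linarith
  have cp : 0 < 1 - b₃ := by linarith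
  have n1 := a1p.ne'
  have n2 := a2p.ne'
  have n3 := a3p.ne'
  have n4 := cp.ne'
  have n5 : a₁ - a₁ * b₃ ≠ 0 := by
    have : a₁ - a₁ * b₃ = a₁ * (1 - b₃) := by ring
    rw [this]; exact mul_ne_zero n1 n4
  have n6 : a₂ - a₂ * b₃ ≠ 0 := by
    have : a₂ - a₂ * b₃ = a₂ * (1 - b₃) := by ring
    rw [this]; exact mul_ne_zero n2 n4
  obtain ⟨lam, hlam⟩ : ∃ lam : ZMod 7 → ℝ,
      lam = (![1 / a₂, 1 / a₃, 1 / a₃, (1 - b₃) / a₃, 1, 1, 1 / a₁] : Fin 7 → ℝ) := ⟨_, rfl⟩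
  have hl : ∀ k, 0 < lam k := by
    rw [hlam]
    intro k
    change Fin 7 at k
    fin_cases k <;> simp <;> positivity
  obtain ⟨M, hM⟩ : ∃ M : Fin 3 → Fin 3 → ℝ,
      M = ![![1, -(a₃ / (1 - b₃)), a₃ / (1 - b₃)], ![1, 0, 0], ![0, a₃, 0]] := ⟨_, rfl⟩
  have hMd : 0 < hepDet (M 0) (M 1) (M 2) := by
    have : hepDet (M 0) (M 1) (M 2) = a₃ / (1 - b₃) * a₃ := by
      rw [hM]; simp [hepDet]
    rw [this]; positivity
  have key : ∀ k r, Wrow ((1 - a₃ - b₃) / (1 - b₃))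
      ((a₁ - a₁ * b₃ - a₃ + a₃ * b₁) / (a₁ - a₁ * b₃))
      ((a₂ - a₂ * b₃ - a₃ + a₃ * b₂) / (a₂ - a₂ * b₃)) a₃ (a₃ / a₁) (a₃ / a₂) k r =
      lam k * (M r 0 * Wrow a₁ a₂ a₃ b₁ b₂ b₃ (k - 1) 0 + M r 1 * Wrow a₁ a₂ a₃ b₁ b₂ b₃ (k - 1) 1
        + M r 2 * Wrow a₁ a₂ a₃ b₁ b₂ b₃ (k - 1) 2) := by
    rw [hlam, hM]
    apply hep_forall
    · rw [show (0 : ZMod 7) - 1 = 6 by decide, hep_W0, hep_W6]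
      intro r; fin_cases r <;> simp <;> field_simp <;> ring
    · rw [show (1 : ZMod 7) - 1 = 0 by decide, hep_W1, hep_W0]
      intro r; fin_cases r <;> simp <;> field_simp <;> first | (right; ring) | ring
    · rw [show (2 : ZMod 7) - 1 = 1 by decide, hep_W2, hep_W1]
      intro r; fin_cases r <;> simp <;> field_simp <;> ring
    · rw [show (3 : ZMod 7) - 1 = 2 by decide, hep_W3, hep_W2]
      intro r; fin_cases r <;> simp <;> field_simp <;> ring
    · rw [show (4 : ZMod 7) - 1 = 3 by decide, hep_W4, hep_W3]
      intro r; fin_cases r <;> simp <;> field_simp <;> ring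
    · rw [show (5 : ZMod 7) - 1 = 4 by decide, hep_W5, hep_W4]
      intro r; fin_cases r <;> simp <;> field_simp <;> ring
    · rw [show (6 : ZMod 7) - 1 = 5 by decide, hep_W6, hep_W5]
      intro r; fin_cases r <;> simp <;> field_simp <;> ring
  refine ⟨fun i => lam (i - 1), fun j => lam (j - 2) * lam (j - 1) * hepDet (M 0) (M 1) (M 2),
    fun i => hl _, fun j => mul_pos (mul_pos (hl _) (hl _)) hMd, fun i j => ?_⟩
  rw [hep_Vmat_apply, hep_Vmat_apply, show j - 1 - 2 = j - 2 - 1 by ring]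
  exact hepDet_smul_mul M _ _ _ _ _ _ _ _ _ (key _) (key _) (key _)

theorem hep_T_zero (a₁ a₂ a₃ b₁ b₂ b₃ : ℝ) :
    hepT (Vmat a₁ a₂ a₃ b₁ b₂ b₃) 0 = (a₁ + b₁) - (a₂ + b₂) := by
  have r := hep_rows a₁ a₂ a₃ b₁ b₂ b₃
  simp only [hepT, add_zero]
  rw [(r 4).2.2.2.2.2.1, (r 0).2.2.1, (r 4).2.2.1, (r 0).2.2.2.2.2.1]
  simp [hepE]; ring

theorem hep_S_zero (a₁ a₂ a₃ b₁ b₂ b₃ : ℝ) :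
    hepS (Vmat a₁ a₂ a₃ b₁ b₂ b₃) 0 = (a₃ + b₃) - (a₂ + b₂) := by
  have r := hep_rows a₁ a₂ a₃ b₁ b₂ b₃
  simp only [hepS, add_zero]
  rw [(r 4).2.2.1, (r 1).2.2.2.2.2.1, (r 1).2.2.1, (r 4).2.2.2.2.2.1]
  simp [hepE]; ring

/-- Quasiconvexity of `a + b` along the chain. -/
theorem hep_quasi {a₁ a₂ a₃ b₁ b₂ b₃ : ℝ} (h : HepPos (Vmat a₁ a₂ a₃ b₁ b₂ b₃)) :
    a₁ + b₁ ≤ a₂ + b₂ → a₃ + b₃ ≤ a₂ + b₂ → False := by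
  obtain ⟨⟨a3p, a32, a21, a11⟩, ⟨b1p, b12, b23, b31⟩, -, -, -, h756, -⟩ := hep_ineqs h
  intro h1 h2
  nlinarith [mul_nonneg (sub_nonneg.2 h1) (sub_nonneg.2 a32.le),
    mul_nonneg (sub_nonneg.2 h2) (sub_nonneg.2 a21.le)]

/-- The matrix at time `t`. -/
noncomputable def hepV (a₁ a₂ a₃ b₁ b₂ b₃ : ℝ) (t : ℕ) : Matrix (ZMod 7) (ZMod 7) ℝ :=
  Vmat (alphaV a₁ a₂ a₃ b₁ b₂ b₃ 0 t) (alphaV a₁ a₂ a₃ b₁ b₂ b₃ 1 t)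
    (alphaV a₁ a₂ a₃ b₁ b₂ b₃ 2 t) (betaV a₁ a₂ a₃ b₁ b₂ b₃ 0 t)
    (betaV a₁ a₂ a₃ b₁ b₂ b₃ 1 t) (betaV a₁ a₂ a₃ b₁ b₂ b₃ 2 t)

theorem hep_shift {a₁ a₂ a₃ b₁ b₂ b₃ : ℝ} (h : HepPos (Vmat a₁ a₂ a₃ b₁ b₂ b₃)) (t : ℕ) :
    HepShift (Vmat a₁ a₂ a₃ b₁ b₂ b₃) (hepV a₁ a₂ a₃ b₁ b₂ b₃ t) (t : ZMod 7) := by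
  induction t with
  | zero =>
    refine ⟨fun _ => 1, fun _ => 1, fun _ => one_pos, fun _ => one_pos, fun i j => ?_⟩
    simp [hepV, alphaV, betaV, seqV]
  | succ t ih =>
    rw [Nat.cast_succ]
    exact ih.comp (hep_step (ih.pos h))

end helpers

/-- If `V = 𝒱(a₁,a₂,a₃,b₁,b₂,b₃)` has positive entries off the pattern
`i ∈ {j-1, j}` and has full nonnegative rank (no nonnegative factorization through 6),
then either `α₁(t) + β₁(t) < α₂(t) + β₂(t) < α₃(t) + β₃(t)` for every `t`, or
`α₁(t) + β₁(t) > α₂(t) + β₂(t) > α₃(t) + β₃(t)` for every `t`. -/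
theorem seqV_monotone_of_full_nonneg_rank (a₁ a₂ a₃ b₁ b₂ b₃ : ℝ)
    (hpos : ∀ i j : ZMod 7, i ≠ j - 1 → i ≠ j → 0 < Vmat a₁ a₂ a₃ b₁ b₂ b₃ i j)
    (hfull : ¬ ∃ (B : Matrix (ZMod 7) (Fin 6) ℝ) (C : Matrix (Fin 6) (ZMod 7) ℝ),
        (∀ i j, 0 ≤ B i j) ∧ (∀ i j, 0 ≤ C i j) ∧
        Vmat a₁ a₂ a₃ b₁ b₂ b₃ = B * C) :
    (∀ t : ℕ,
      alphaV a₁ a₂ a₃ b₁ b₂ b₃ 0 t + betaV a₁ a₂ a₃ b₁ b₂ b₃ 0 t <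
        alphaV a₁ a₂ a₃ b₁ b₂ b₃ 1 t + betaV a₁ a₂ a₃ b₁ b₂ b₃ 1 t ∧
      alphaV a₁ a₂ a₃ b₁ b₂ b₃ 1 t + betaV a₁ a₂ a₃ b₁ b₂ b₃ 1 t <
        alphaV a₁ a₂ a₃ b₁ b₂ b₃ 2 t + betaV a₁ a₂ a₃ b₁ b₂ b₃ 2 t) ∨
    (∀ t : ℕ,
      alphaV a₁ a₂ a₃ b₁ b₂ b₃ 1 t + betaV a₁ a₂ a₃ b₁ b₂ b₃ 1 t <
        alphaV a₁ a₂ a₃ b₁ b₂ b₃ 0 t + betaV a₁ a₂ a₃ b₁ b₂ b₃ 0 t ∧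
      alphaV a₁ a₂ a₃ b₁ b₂ b₃ 2 t + betaV a₁ a₂ a₃ b₁ b₂ b₃ 2 t <
        alphaV a₁ a₂ a₃ b₁ b₂ b₃ 1 t + betaV a₁ a₂ a₃ b₁ b₂ b₃ 1 t) := by
  have hp : HepPos (Vmat a₁ a₂ a₃ b₁ b₂ b₃) := hpos
  have hf : ¬ HepFac (Vmat a₁ a₂ a₃ b₁ b₂ b₃) := hfull
  have hsh := hep_shift hp
  have surj : ∀ k : ZMod 7, ∃ t : ℕ, k = 0 - (t : ZMod 7) := fun k =>
    ⟨(-k).val, by rw [ZMod.natCast_zmod_val]; ring⟩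
  obtain ⟨V, hV⟩ : ∃ V, V = Vmat a₁ a₂ a₃ b₁ b₂ b₃ := ⟨_, rfl⟩
  rw [← hV] at hp hf hsh
  have hTt : ∀ t : ℕ, ∃ e : ℝ, 0 < e ∧
      (alphaV a₁ a₂ a₃ b₁ b₂ b₃ 0 t + betaV a₁ a₂ a₃ b₁ b₂ b₃ 0 t) -
        (alphaV a₁ a₂ a₃ b₁ b₂ b₃ 1 t + betaV a₁ a₂ a₃ b₁ b₂ b₃ 1 t)
        = e * hepT V (0 - (t : ZMod 7)) := by
    intro t
    rw [← hep_T_zero _ _ (alphaV a₁ a₂ a₃ b₁ b₂ b₃ 2 t) _ _ (betaV a₁ a₂ a₃ b₁ b₂ b₃ 2 t)]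
    exact (hsh t).T 0
  have hSt : ∀ t : ℕ, ∃ e : ℝ, 0 < e ∧
      (alphaV a₁ a₂ a₃ b₁ b₂ b₃ 2 t + betaV a₁ a₂ a₃ b₁ b₂ b₃ 2 t) -
        (alphaV a₁ a₂ a₃ b₁ b₂ b₃ 1 t + betaV a₁ a₂ a₃ b₁ b₂ b₃ 1 t)
        = e * hepS V (0 - (t : ZMod 7)) := by
    intro t
    rw [← hep_S_zero (alphaV a₁ a₂ a₃ b₁ b₂ b₃ 0 t) _ _ (betaV a₁ a₂ a₃ b₁ b₂ b₃ 0 t)]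
    exact (hsh t).S 0
  have quasi : ∀ k, hepT V k ≤ 0 → hepS V k ≤ 0 → False := by
    intro k h1 h2
    obtain ⟨t, rfl⟩ := surj k
    obtain ⟨e, he, hT⟩ := hTt t
    obtain ⟨e', he', hS⟩ := hSt t
    refine hep_quasi ((hsh t).pos hp) ?_ ?_
    · have := mul_nonpos_of_nonneg_of_nonpos he.le h1
      linarith
    · have := mul_nonpos_of_nonneg_of_nonpos he'.le h2
      linarith
  have nofac : ∀ k, 0 ≤ hepT V (2 + k) → hepS V (-2 + k) < 0 := by
    intro k h1
    obtain ⟨t, rfl⟩ := surj k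
    by_contra h2
    push Not at h2
    refine hf ((hsh t).fac (hep_factor ((hsh t).pos hp) ?_ ?_))
    · obtain ⟨e, he, hT⟩ := (hsh t).T 2
      refine (mul_nonneg he.le ?_).trans hT.ge
      rwa [show (2 : ZMod 7) - (t : ZMod 7) = 2 + (0 - (t : ZMod 7)) by ring]
    · obtain ⟨e, he, hS⟩ := (hsh t).S (-2)
      refine (mul_nonneg he.le ?_).trans hS.ge
      rwa [show (-2 : ZMod 7) - (t : ZMod 7) = -2 + (0 - (t : ZMod 7)) by ring]
  have move : ∀ k, 0 ≤ hepT V k → 0 < hepT V (k + 3) ∧ hepS V (k + 3) < 0 := by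
    intro k hk
    have h1 := nofac (k - 2) (by rwa [show 2 + (k - 2) = k by ring])
    have e : -2 + (k - 2) = k + 3 := by
      have : (7 : ZMod 7) = 0 := by decide
      linear_combination -this
    rw [e] at h1
    exact ⟨not_le.1 fun h2 => quasi _ h2 h1.le, h1⟩
  by_cases hk : ∃ k, 0 ≤ hepT V k
  · right
    obtain ⟨k, hk⟩ := hk
    have it : ∀ n : ℕ, 0 ≤ hepT V (k + 3 * n) := by
      intro n
      induction n with
      | zero => simpa using hk
      | succ n ih =>
        have := (move _ ih).1.le
        rwa [show k + 3 * ((n + 1 : ℕ) : ZMod 7) = k + 3 * (n : ZMod 7) + 3 by push_cast; ring]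
    have all : ∀ l, 0 < hepT V l ∧ hepS V l < 0 := by
      intro l
      have := move _ (it ((5 * (l - 3 - k)).val))
      rw [ZMod.natCast_zmod_val] at this
      have e : k + 3 * (5 * (l - 3 - k)) + 3 = l := by
        have : (7 : ZMod 7) = 0 := by decide
        linear_combination 2 * (l - 3 - k) * this
      rwa [e] at this
    intro t
    obtain ⟨e, he, hT⟩ := hTt t
    obtain ⟨e', he', hS⟩ := hSt t
    have h1 := mul_pos he (all (0 - (t : ZMod 7))).1
    have h2 := mul_neg_of_pos_of_neg he' (all (0 - (t : ZMod 7))).2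
    constructor <;> linarith
  · left
    push Not at hk
    intro t
    obtain ⟨e, he, hT⟩ := hTt t
    obtain ⟨e', he', hS⟩ := hSt t
    have h1 := mul_neg_of_pos_of_neg he (hk (0 - (t : ZMod 7)))
    have h2 := mul_pos he' (not_le.1 (quasi (0 - (t : ZMod 7)) (hk _).le))
    constructor <;> linarith
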